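/- Let r > 0. As ε → 0⁺, C₁₁(ε) − 2π (α̃(ε)/ξ₀(ε)) · [γ + 2 log 2 + log(√r) − log(√ε)] = O(ε), where γ is the Euler–Mascheroni constant. -/

import Mathlib

open Real Filter Topology

/-- The parameter α̃(ε) = √(ε(r + ε/4)) for two identical spheres of radius `r`. -/
noncomputable def alphaTilde (r ε : ℝ) : ℝ := Real.sqrt (ε * (r + ε / 4))

/-- The bispherical coordinate ξ₀(ε) = arsinh(α̃(ε)/r) of the sphere boundaries. -/
noncomputable def xi0 (r ε : ℝ) : ℝ := Real.arsinh (alphaTilde r ε / r)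

/-- The capacitance coefficient C₁₁ for two identical spheres of radius `r`. -/
noncomputable def C11sym (r ε : ℝ) : ℝ :=
  8 * π * alphaTilde r ε *
    ∑' n : ℕ, Real.exp ((2 * n + 1) * xi0 r ε) /
      (Real.exp (2 * (2 * n + 1) * xi0 r ε) - 1)

/-- The capacitance coefficient C₁₂ for two identical spheres of radius `r`. -/
noncomputable def C12sym (r ε : ℝ) : ℝ :=
  -(8 * π * alphaTilde r ε *
    ∑' n : ℕ, 1 / (Real.exp (2 * (2 * n + 1) * xi0 r ε) - 1))

theorem intervalIntegrable_of_integrableOn_Ioi {f : ℝ → ℝ}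
    (hi : MeasureTheory.IntegrableOn f (Set.Ioi 0)) {a b : ℝ} (ha : 0 ≤ a) (hab : a ≤ b) :
    IntervalIntegrable f MeasureTheory.volume a b := by
  rw [intervalIntegrable_iff_integrableOn_Ioc_of_le hab]
  exact hi.mono_set fun t ht => lt_of_le_of_lt ha ht.1

theorem integral_symm_interval_eq {f : ℝ → ℝ}
    (hi : MeasureTheory.IntegrableOn f (Set.Ioi 0)) {c x : ℝ} (hx : 0 ≤ x) (hc : x ≤ c) :
    IntervalIntegrable (fun t => f (c - t) + f (c + t)) MeasureTheory.volume 0 x ∧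
    ∫ t in (c - x)..(c + x), f t = ∫ t in (0 : ℝ)..x, (f (c - t) + f (c + t)) := by
  have h1 : IntervalIntegrable f MeasureTheory.volume (c - x) c :=
    intervalIntegrable_of_integrableOn_Ioi hi (by linarith) (by linarith)
  have h2 : IntervalIntegrable f MeasureTheory.volume c (c + x) :=
    intervalIntegrable_of_integrableOn_Ioi hi (by linarith) (by linarith)
  have h1' : IntervalIntegrable (fun t => f (c - t)) MeasureTheory.volume 0 x := by
    simpa using (h1.comp_sub_left c).symm
  have h2' : IntervalIntegrable (fun t => f (c + t)) MeasureTheory.volume 0 x := by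
    simpa using h2.comp_add_left c
  refine ⟨h1'.add h2', ?_⟩
  rw [intervalIntegral.integral_add h1' h2', intervalIntegral.integral_comp_sub_left,
    intervalIntegral.integral_comp_add_left, sub_zero, add_zero,
    intervalIntegral.integral_add_adjacent_intervals h1 h2]

theorem ConvexOn.two_mul_midpoint_le {f : ℝ → ℝ} (hf : ConvexOn ℝ (Set.Ioi 0) f) {c t : ℝ}
    (ht : 0 ≤ t) (htc : t < c) : 2 * f c ≤ f (c - t) + f (c + t) := by
  have := hf.2 (show c - t ∈ Set.Ioi (0 : ℝ) from sub_pos.2 htc)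
    (show c + t ∈ Set.Ioi (0 : ℝ) by simp; linarith)
    (show (0 : ℝ) ≤ 1 / 2 by norm_num) (show (0 : ℝ) ≤ 1 / 2 by norm_num) (by norm_num)
  simp only [smul_eq_mul] at this
  rw [show 1 / 2 * (c - t) + 1 / 2 * (c + t) = c by ring] at this
  linarith

theorem ConvexOn.add_le_endpoints {f : ℝ → ℝ} (hf : ConvexOn ℝ (Set.Ioi 0) f) {c x t : ℝ}
    (hx : 0 < x) (hxc : x < c) (ht : 0 ≤ t) (htx : t ≤ x) :
    f (c - t) + f (c + t) ≤ f (c - x) + f (c + x) := by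
  have ha : c - x ∈ Set.Ioi (0 : ℝ) := sub_pos.2 hxc
  have hb : c + x ∈ Set.Ioi (0 : ℝ) := by simp; linarith
  have hp : 0 ≤ (x + t) / (2 * x) := by positivity
  have hq : 0 ≤ (x - t) / (2 * x) := div_nonneg (by linarith) (by linarith)
  have hpq : (x + t) / (2 * x) + (x - t) / (2 * x) = 1 := by field_simp; ring
  have h1 := hf.2 ha hb hp hq hpq
  have h2 := hf.2 ha hb hq hp (by rw [add_comm]; exact hpq)
  simp only [smul_eq_mul] at h1 h2
  rw [show (x + t) / (2 * x) * (c - x) + (x - t) / (2 * x) * (c + x) = c - t by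
    field_simp; ring] at h1
  rw [show (x - t) / (2 * x) * (c - x) + (x + t) / (2 * x) * (c + x) = c + t by
    field_simp; ring] at h2
  have e : (x - t) / (2 * x) = 1 - (x + t) / (2 * x) := by linarith
  rw [e] at h1 h2
  linarith

theorem ConvexOn.midpoint_le_integral {f : ℝ → ℝ} (hf : ConvexOn ℝ (Set.Ioi 0) f)
    (hi : MeasureTheory.IntegrableOn f (Set.Ioi 0)) {c x : ℝ} (hx : 0 ≤ x) (hc : x ≤ c) :
    2 * x * f c ≤ ∫ t in (c - x)..(c + x), f t := by
  obtain ⟨hint, he⟩ := integral_symm_interval_eq hi hx hc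
  rw [he]
  have := intervalIntegral.integral_mono_on_of_le_Ioo hx
    (intervalIntegrable_const (c := 2 * f c)) hint
    fun t ht => hf.two_mul_midpoint_le ht.1.le (ht.2.trans_le hc)
  rw [intervalIntegral.integral_const, smul_eq_mul] at this
  linarith

theorem ConvexOn.integral_le_trapezoid {f : ℝ → ℝ} (hf : ConvexOn ℝ (Set.Ioi 0) f)
    (hi : MeasureTheory.IntegrableOn f (Set.Ioi 0)) {c x : ℝ} (hx : 0 < x) (hc : x < c) :
    ∫ t in (c - x)..(c + x), f t ≤ x * (f (c - x) + f (c + x)) := by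
  obtain ⟨hint, he⟩ := integral_symm_interval_eq hi hx.le hc.le
  rw [he]
  have := intervalIntegral.integral_mono_on_of_le_Ioo hx.le hint
    (intervalIntegrable_const (c := f (c - x) + f (c + x)))
    fun t ht => hf.add_le_endpoints hx hc ht.1.le ht.2.le
  rw [intervalIntegral.integral_const, smul_eq_mul] at this
  linarith

/-- The midpoint rule with step `2 * x` on `(0, ∞)` has error `O(x ^ 2)` for a convex integrable
function whose slope near the origin is bounded below. -/
theorem ConvexOn.abs_integral_sub_midpoint_le {f : ℝ → ℝ} (hf : ConvexOn ℝ (Set.Ioi 0) f)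
    (hi : MeasureTheory.IntegrableOn f (Set.Ioi 0)) {x C : ℝ} (hx : 0 < x)
    (hs : Summable fun n : ℕ => f ((2 * n + 1) * x))
    (hC : ∀ y, 0 < y → y ≤ x → f y ≤ f x + C * x) :
    |(∫ t in Set.Ioi (0 : ℝ), f t) - 2 * x * ∑' n : ℕ, f ((2 * n + 1) * x)| ≤ C * x ^ 2 := by
  have hlow : ∀ N : ℕ, 2 * x * ∑ n ∈ Finset.range N, f ((2 * n + 1) * x) ≤
      ∫ t in (0 : ℝ)..(2 * N * x), f t := by
    intro N
    induction N with
    | zero => simp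
    | succ N ih =>
      have hN : (0 : ℝ) ≤ N * x := by positivity
      have h := hf.midpoint_le_integral hi (c := (2 * N + 1) * x) hx.le (by linarith)
      rw [show ((2 * N + 1) * x - x : ℝ) = 2 * N * x by ring,
        show ((2 * N + 1) * x + x : ℝ) = 2 * (N + 1 : ℕ) * x by push_cast; ring] at h
      rw [Finset.sum_range_succ, ← intervalIntegral.integral_add_adjacent_intervals
        (intervalIntegrable_of_integrableOn_Ioi hi le_rfl (by linarith))
        (intervalIntegrable_of_integrableOn_Ioi hi (a := 2 * N * x) (by linarith)
          (by push_cast; linarith))]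
      linarith
  have hup : ∀ N : ℕ, ∫ t in x..((2 * N + 1) * x), f t ≤
      2 * x * ∑ n ∈ Finset.range N, f ((2 * n + 1) * x) - x * f x + x * f ((2 * N + 1) * x) := by
    intro N
    induction N with
    | zero => simp
    | succ N ih =>
      have hN : (0 : ℝ) ≤ N * x := by positivity
      have h := hf.integral_le_trapezoid hi (c := (2 * N + 2) * x) hx (by linarith)
      rw [show ((2 * N + 2) * x - x : ℝ) = (2 * N + 1) * x by ring,
        show ((2 * N + 2) * x + x : ℝ) = (2 * (N + 1 : ℕ) + 1) * x by push_cast; ring] at h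
      rw [Finset.sum_range_succ, ← intervalIntegral.integral_add_adjacent_intervals
        (intervalIntegrable_of_integrableOn_Ioi hi hx.le (by linarith))
        (intervalIntegrable_of_integrableOn_Ioi hi (a := (2 * N + 1) * x) (by linarith)
          (by push_cast; linarith))]
      linarith
  have hsum := hs.hasSum.tendsto_sum_nat
  have hzero := hs.tendsto_atTop_zero
  have hN2 : Tendsto (fun N : ℕ => 2 * (N : ℝ) * x) atTop atTop :=
    (tendsto_natCast_atTop_atTop.const_mul_atTop two_pos).atTop_mul_const hx
  have hN1 : Tendsto (fun N : ℕ => (2 * (N : ℝ) + 1) * x) atTop atTop :=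
    (tendsto_atTop_add_const_right _ 1
      (tendsto_natCast_atTop_atTop.const_mul_atTop two_pos)).atTop_mul_const hx
  have hL := le_of_tendsto_of_tendsto' (hsum.const_mul (2 * x))
    (MeasureTheory.intervalIntegral_tendsto_integral_Ioi 0 hi hN2) hlow
  have hix : MeasureTheory.IntegrableOn f (Set.Ioi x) :=
    hi.mono_set (Set.Ioi_subset_Ioi hx.le)
  have hU := le_of_tendsto_of_tendsto'
    (MeasureTheory.intervalIntegral_tendsto_integral_Ioi x hix hN1)
    (((hsum.const_mul (2 * x)).sub_const (x * f x)).add (hzero.const_mul x)) hup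
  have hfirst : ∫ t in (0 : ℝ)..x, f t ≤ x * (f x + C * x) := by
    have := intervalIntegral.integral_mono_on_of_le_Ioo hx.le
      (intervalIntegrable_of_integrableOn_Ioi hi le_rfl hx.le)
      (intervalIntegrable_const (c := f x + C * x)) fun t ht => hC t ht.1 ht.2.le
    rw [intervalIntegral.integral_const, smul_eq_mul, sub_zero] at this
    exact this
  have hsplit := intervalIntegral.integral_Ioi_sub_Ioi hi hx.le
  rw [abs_le]
  constructor <;> nlinarith

theorem integral_exp_neg_mul_log :
    ∫ t in Set.Ioi (0 : ℝ), Real.exp (-t) * Real.log t = -Real.eulerMascheroniConstant := by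
  have h1 := Complex.hasDerivAt_GammaIntegral (s := 1) (by simp)
  have h2 : HasDerivAt Complex.GammaIntegral (-(Real.eulerMascheroniConstant : ℂ)) 1 := by
    refine Complex.hasDerivAt_Gamma_one.congr_of_eventuallyEq ?_
    have : {s : ℂ | 0 < s.re} ∈ 𝓝 (1 : ℂ) :=
      (isOpen_lt continuous_const Complex.continuous_re).mem_nhds (by simp)
    filter_upwards [this] with s hs using (Complex.Gamma_eq_integral hs).symm
  have h3 := h1.unique h2
  have h4 : ∫ t in Set.Ioi (0 : ℝ), ((t : ℂ) ^ ((1 : ℂ) - 1) * (Real.log t * Real.exp (-t))) =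
      ((∫ t in Set.Ioi (0 : ℝ), Real.exp (-t) * Real.log t : ℝ) : ℂ) := by
    rw [← integral_complex_ofReal]
    congr 1
    ext t
    simp [mul_comm]
  rw [h4] at h3
  exact_mod_cast h3

theorem integrableOn_exp_neg_mul_log :
    MeasureTheory.IntegrableOn (fun t => Real.exp (-t) * Real.log t) (Set.Ioi 0) := by
  by_contra h
  have := MeasureTheory.integral_undef h
  rw [integral_exp_neg_mul_log] at this
  linarith [Real.one_half_lt_eulerMascheroniConstant]

/-- The difference between `1 / sinh y` and its exponentially damped singular part. -/
noncomputable def sinhGap (y : ℝ) : ℝ := 1 / Real.sinh y - Real.exp (-y) / y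

theorem sinhGap_bounds {y : ℝ} (hy : 0 < y) :
    0 ≤ sinhGap y ∧ sinhGap y ≤ 4 * Real.exp (-(1 / 2) * y) := by
  have hs : 0 < Real.sinh y := Real.sinh_pos_iff.2 hy
  have hE : Real.exp (-(2 * y)) = Real.exp (-y) * Real.exp (-y) := by
    rw [← Real.exp_add]; ring_nf
  have h1 : Real.exp (-y) * Real.exp y = 1 := by rw [← Real.exp_add]; simp
  have hsE : 2 * (Real.exp (-y) * Real.sinh y) = 1 - Real.exp (-(2 * y)) := by
    rw [Real.sinh_eq, hE]; linear_combination h1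
  have hpos := Real.exp_pos (-y)
  constructor
  · have h2 := Real.add_one_le_exp (-(2 * y))
    rw [sinhGap, sub_nonneg, div_le_div_iff₀ hy hs]
    linarith
  · have h2 : Real.exp (-(2 * y)) * (1 + 2 * y) ≤ 1 := by
      have := Real.add_one_le_exp (2 * y)
      calc _ ≤ Real.exp (-(2 * y)) * Real.exp (2 * y) := by gcongr; linarith
        _ = 1 := by rw [← Real.exp_add]; simp
    have h3 : 1 / Real.sinh y ≤ Real.exp (-y) * (1 + 2 * y) / y := by
      rw [div_le_div_iff₀ hs hy]
      nlinarith
    have h4 : sinhGap y ≤ 2 * Real.exp (-y) := by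
      rw [sinhGap]
      calc _ ≤ Real.exp (-y) * (1 + 2 * y) / y - Real.exp (-y) / y := by gcongr
        _ = _ := by field_simp; ring
    have h5 : Real.exp (-y) ≤ Real.exp (-(1 / 2) * y) := Real.exp_le_exp.2 (by linarith)
    linarith [Real.exp_pos (-(1 / 2) * y)]

theorem continuousOn_sinhGap : ContinuousOn sinhGap (Set.Ioi 0) := by
  unfold sinhGap
  refine ContinuousOn.sub (ContinuousOn.div (by fun_prop) (by fun_prop) ?_)
    (ContinuousOn.div (by fun_prop) (by fun_prop) ?_)
  · exact fun x hx => (Real.sinh_pos_iff.2 hx).ne'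
  · exact fun x hx => (Set.mem_Ioi.1 hx).ne'

theorem integrableOn_sinhGap : MeasureTheory.IntegrableOn sinhGap (Set.Ioi 0) := by
  refine MeasureTheory.Integrable.mono'
    ((integrableOn_exp_mul_Ioi (a := -(1 / 2)) (by norm_num) 0).const_mul 4)
    (continuousOn_sinhGap.aestronglyMeasurable measurableSet_Ioi) ?_
  refine (MeasureTheory.ae_restrict_mem measurableSet_Ioi).mono fun y hy => ?_
  rw [Real.norm_of_nonneg (sinhGap_bounds hy).1]
  exact (sinhGap_bounds hy).2

theorem inv_sinh_eq_exp {y : ℝ} (hy : 0 < y) :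
    1 / Real.sinh y =
      Real.exp (-y) / (1 - Real.exp (-y)) + Real.exp (-y) / (1 + Real.exp (-y)) := by
  have h0 := Real.exp_pos (-y)
  have h1 : Real.exp (-y) < 1 := Real.exp_lt_one_iff.2 (by linarith)
  have hs : 0 < Real.sinh y := Real.sinh_pos_iff.2 hy
  have h2 : 1 - Real.exp (-y) ≠ 0 := by linarith
  have h3 : 1 + Real.exp (-y) ≠ 0 := by linarith
  have h4 : Real.exp (-y) * Real.exp y = 1 := by rw [← Real.exp_add]; simp
  rw [div_add_div _ _ h2 h3, div_eq_div_iff hs.ne' (mul_ne_zero h2 h3), Real.sinh_eq]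
  linear_combination -h4

theorem tendsto_one_sub_exp_neg_div :
    Tendsto (fun y : ℝ => (1 - Real.exp (-y)) / y) (𝓝[>] 0) (𝓝 1) := by
  have h : HasDerivAt (fun y : ℝ => 1 - Real.exp (-y)) 1 0 := by
    have := ((hasDerivAt_neg (0 : ℝ)).exp).const_sub 1
    simpa using this
  have := h.tendsto_slope_zero_right
  refine this.congr fun y => ?_
  simp [div_eq_inv_mul]

theorem integral_sinhGap :
    ∫ y in Set.Ioi (0 : ℝ), sinhGap y = Real.eulerMascheroniConstant + Real.log 2 := by
  set G : ℝ → ℝ := fun y =>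
    Real.log (1 - Real.exp (-y)) - Real.log (1 + Real.exp (-y)) - Real.exp (-y) * Real.log y with hG
  have hderiv : ∀ y ∈ Set.Ioi (0 : ℝ),
      HasDerivAt G (sinhGap y + Real.exp (-y) * Real.log y) y := by
    intro y hy
    have hy' : 0 < y := hy
    have h1 : Real.exp (-y) < 1 := Real.exp_lt_one_iff.2 (by linarith)
    have h0 := Real.exp_pos (-y)
    have he : HasDerivAt (fun y : ℝ => Real.exp (-y)) (-Real.exp (-y)) y := by
      simpa using (hasDerivAt_neg y).exp
    have := (((he.const_sub 1).log (by linarith)).sub ((he.const_add 1).log (by linarith))).sub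
      (he.mul (Real.hasDerivAt_log hy'.ne'))
    refine this.congr_deriv ?_
    rw [sinhGap, inv_sinh_eq_exp hy']
    ring
  have htop : Tendsto G atTop (𝓝 0) := by
    have he : Tendsto (fun y : ℝ => Real.exp (-y)) atTop (𝓝 0) :=
      Real.tendsto_exp_neg_atTop_nhds_zero
    have h1 : Tendsto (fun y : ℝ => Real.log (1 - Real.exp (-y))) atTop (𝓝 0) := by
      simpa using (he.const_sub 1).log (by norm_num)
    have h2 : Tendsto (fun y : ℝ => Real.log (1 + Real.exp (-y))) atTop (𝓝 0) := by
      simpa using (he.const_add 1).log (by norm_num)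
    have h3 : Tendsto (fun y : ℝ => Real.exp (-y) * Real.log y) atTop (𝓝 0) := by
      have hz : Tendsto (fun y : ℝ => y * Real.exp (-y)) atTop (𝓝 0) := by
        simpa using Real.tendsto_pow_mul_exp_neg_atTop_nhds_zero 1
      refine squeeze_zero' ?_ ?_ hz
      · filter_upwards [eventually_ge_atTop 1] with y hy
        exact mul_nonneg (Real.exp_pos _).le (Real.log_nonneg hy)
      · filter_upwards [eventually_ge_atTop 1] with y hy
        rw [mul_comm]
        gcongr
        linarith [Real.log_le_sub_one_of_pos (show 0 < y by linarith)]
    simpa using (h1.sub h2).sub h3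
  have hbot : Tendsto G (𝓝[>] 0) (𝓝 (-Real.log 2)) := by
    have h1 : Tendsto (fun y : ℝ => Real.log ((1 - Real.exp (-y)) / y)) (𝓝[>] 0) (𝓝 0) := by
      simpa using tendsto_one_sub_exp_neg_div.log one_ne_zero
    have h2 : Tendsto (fun y : ℝ => Real.log (1 + Real.exp (-y))) (𝓝[>] 0) (𝓝 (Real.log 2)) := by
      have : ContinuousAt (fun y : ℝ => Real.log (1 + Real.exp (-y))) 0 := by
        refine ContinuousAt.log (by fun_prop) ?_
        norm_num
      have := this.tendsto.mono_left (nhdsWithin_le_nhds (s := Set.Ioi 0))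
      simpa [one_add_one_eq_two] using this
    have h3 : Tendsto (fun y : ℝ => (1 - Real.exp (-y)) / y * (Real.log y * y)) (𝓝[>] 0) (𝓝 0) := by
      have hl : Tendsto (fun y : ℝ => Real.log y * y) (𝓝[>] 0) (𝓝 0) := by
        simpa using tendsto_log_mul_rpow_nhdsGT_zero one_pos
      simpa using tendsto_one_sub_exp_neg_div.mul hl
    have h4 := (h1.sub h2).add h3
    rw [zero_sub, add_zero] at h4
    refine h4.congr' ?_
    filter_upwards [self_mem_nhdsWithin] with y hy
    have hy' : 0 < y := hy
    have h1 : Real.exp (-y) < 1 := Real.exp_lt_one_iff.2 (by linarith)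
    rw [Real.log_div (by linarith) hy'.ne']
    simp only [hG]
    field_simp
    ring
  have hint := integrableOn_sinhGap.add integrableOn_exp_neg_mul_log
  have := MeasureTheory.integral_Ioi_of_hasDerivAt_of_tendsto
    (f := Function.update G 0 (-Real.log 2)) (f' := fun y => sinhGap y + Real.exp (-y) * Real.log y)
    (a := 0) (m := 0) ?_ ?_ hint ?_
  · rw [MeasureTheory.integral_add integrableOn_sinhGap integrableOn_exp_neg_mul_log,
      integral_exp_neg_mul_log, Function.update_self] at this
    linarith
  · rw [continuousWithinAt_update_same]
    simpa using hbot
  · intro y hy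
    refine (hderiv y hy).congr_of_eventuallyEq ?_
    filter_upwards [lt_mem_nhds hy] with z hz
    exact Function.update_of_ne (ne_of_gt hz) _ _
  · refine htop.congr' ?_
    filter_upwards [eventually_gt_atTop 0] with z hz
    exact (Function.update_of_ne (ne_of_gt hz) _ _).symm

theorem sinh_le_of_le_one {y : ℝ} (hy : 0 < y) (hy1 : y ≤ 1) :
    Real.sinh y ≤ y * (1 + (y ^ 2 / 6 + y ^ 3 / 16)) := by
  have h1 := Real.exp_bound (x := y) (by rw [abs_of_pos hy]; exact hy1) (n := 4) (by norm_num)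
  have h2 := Real.exp_bound (x := -y) (by rw [abs_neg, abs_of_pos hy]; exact hy1)
    (n := 4) (by norm_num)
  rw [abs_neg] at h2
  rw [abs_of_pos hy] at h1 h2
  norm_num [Finset.sum_range_succ, Nat.factorial] at h1 h2
  rw [abs_le] at h1 h2
  have h4 : 0 < y ^ 4 := by positivity
  rw [Real.sinh_eq]
  linarith [h1.2, h2.1]

theorem exp_neg_mul_quadratic_le_one {y : ℝ} (hy : 0 < y) :
    Real.exp (-y) * (1 + y + y ^ 2 / 2) ≤ 1 := by
  have h := Real.quadratic_le_exp_of_nonneg hy.le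
  calc _ ≤ Real.exp (-y) * Real.exp y := by gcongr
    _ = 1 := by rw [← Real.exp_add]; simp

theorem sinhGap_le_one {y : ℝ} (hy : 0 < y) : sinhGap y ≤ 1 := by
  have h1 : 1 / Real.sinh y ≤ 1 / y :=
    one_div_le_one_div_of_le hy (Real.self_le_sinh_iff.2 hy.le)
  have h2 : (1 - y) / y ≤ Real.exp (-y) / y := by
    gcongr
    linarith [Real.add_one_le_exp (-y)]
  have h3 : (1 - y) / y = 1 / y - 1 := by field_simp
  rw [sinhGap]
  linarith

theorem one_sub_le_sinhGap {x : ℝ} (hx : 0 < x) (hx1 : x ≤ 1) : 1 - 2 * x ≤ sinhGap x := by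
  have hs : 0 < Real.sinh x := Real.sinh_pos_iff.2 hx
  have h1 : 1 / x - x / 4 ≤ 1 / Real.sinh x := by
    have hb : Real.sinh x ≤ x * (1 + x ^ 2 / 4) := by
      refine (sinh_le_of_le_one hx hx1).trans ?_
      gcongr
      nlinarith [pow_pos hx 2]
    rw [le_div_iff₀ hs]
    have hc : 0 ≤ 1 / x - x / 4 := by
      rw [sub_nonneg, le_div_iff₀ hx]
      nlinarith
    calc _ ≤ (1 / x - x / 4) * (x * (1 + x ^ 2 / 4)) := by gcongr
      _ = 1 - x ^ 4 / 16 := by field_simp; ring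
      _ ≤ 1 := by linarith [pow_pos hx 4]
  have h2 : Real.exp (-x) ≤ 1 - x + x ^ 2 := by
    have h := exp_neg_mul_quadratic_le_one hx
    have hp : 0 < 1 + x + x ^ 2 / 2 := by positivity
    refine le_of_mul_le_mul_right (h.trans ?_) hp
    nlinarith [pow_pos hx 2, pow_pos hx 3, pow_pos hx 4]
  have h3 : Real.exp (-x) / x ≤ 1 / x - 1 + x := by
    rw [div_le_iff₀ hx]
    field_simp
    linarith
  rw [sinhGap]
  linarith

theorem sinhGap_second_deriv_lower_bound {y : ℝ} (hy : 0 < y) :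
    0 ≤ 1 / Real.sinh y + 2 / Real.sinh y ^ 3 -
      Real.exp (-y) * (1 / y + 2 / y ^ 2 + 2 / y ^ 3) + 6 * Real.exp (-y) := by
  have hs : 0 < Real.sinh y := Real.sinh_pos_iff.2 hy
  have hpos := Real.exp_pos (-y)
  rcases le_total 1 y with h1 | h1
  · have e1 : 1 / y ≤ 1 := by rw [div_le_one hy]; exact h1
    have e2 : 2 / y ^ 2 ≤ 2 := div_le_self (by norm_num) (one_le_pow₀ h1)
    have e3 : 2 / y ^ 3 ≤ 2 := div_le_self (by norm_num) (one_le_pow₀ h1)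
    have p1 : 0 < 1 / Real.sinh y + 2 / Real.sinh y ^ 3 := by positivity
    nlinarith
  · have hgap := (sinhGap_bounds hy).1
    rw [sinhGap] at hgap
    set q := y ^ 2 / 6 + y ^ 3 / 16 with hq
    have hy2 : y ^ 2 ≤ 1 := pow_le_one₀ hy.le h1
    have hy3 : y ^ 3 ≤ 1 := pow_le_one₀ hy.le h1
    have hq0 : 0 ≤ q := by positivity
    have hq1 : 0 ≤ 1 - 3 * q := by rw [hq]; linarith
    have hs3 : (1 - 3 * q) / y ^ 3 ≤ 1 / Real.sinh y ^ 3 := by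
      rw [div_le_div_iff₀ (by positivity) (by positivity)]
      calc (1 - 3 * q) * Real.sinh y ^ 3 ≤ (1 - 3 * q) * (y * (1 + q)) ^ 3 := by
            gcongr
            exact sinh_le_of_le_one hy h1
        _ = (1 - (6 * q ^ 2 + 8 * q ^ 3 + 3 * q ^ 4)) * y ^ 3 := by ring
        _ ≤ 1 * y ^ 3 := by
            gcongr
            linarith [show 0 ≤ 6 * q ^ 2 + 8 * q ^ 3 + 3 * q ^ 4 by positivity]
    have he : Real.exp (-y) * (1 + y) ≤ 1 - y ^ 2 / 2 + 3 / 4 * y ^ 3 := by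
      have h := exp_neg_mul_quadratic_le_one hy
      have hp : 0 < 1 + y + y ^ 2 / 2 := by positivity
      refine le_of_mul_le_mul_right (a := 1 + y + y ^ 2 / 2) ?_ hp
      have : Real.exp (-y) * (1 + y) * (1 + y + y ^ 2 / 2) ≤ 1 + y := by nlinarith
      refine this.trans ?_
      nlinarith [pow_pos hy 2, pow_pos hy 3, pow_pos hy 4, pow_pos hy 5]
    have he3 : Real.exp (-y) * (2 / y ^ 2 + 2 / y ^ 3) ≤
        2 * ((1 - y ^ 2 / 2 + 3 / 4 * y ^ 3) / y ^ 3) := by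
      have : Real.exp (-y) * (2 / y ^ 2 + 2 / y ^ 3) =
          2 * (Real.exp (-y) * (1 + y) / y ^ 3) := by field_simp; ring
      rw [this]
      gcongr
    have hdiff : (1 - y ^ 2 / 2 + 3 / 4 * y ^ 3) / y ^ 3 - (1 - 3 * q) / y ^ 3 = 15 / 16 := by
      rw [hq]; field_simp; ring
    have h6 : 1 / 3 ≤ Real.exp (-y) := by
      have h3 : Real.exp y ≤ 3 :=
        (Real.exp_le_exp.2 h1).trans (by linarith [Real.exp_one_lt_d9])
      rw [Real.exp_neg, ← one_div]
      exact one_div_le_one_div_of_le (Real.exp_pos y) h3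
    have hexp : Real.exp (-y) * (1 / y + 2 / y ^ 2 + 2 / y ^ 3) =
        Real.exp (-y) / y + Real.exp (-y) * (2 / y ^ 2 + 2 / y ^ 3) := by ring
    have h2 : 2 / Real.sinh y ^ 3 = 2 * (1 / Real.sinh y ^ 3) := by ring
    rw [hexp, h2]
    linarith

theorem convexOn_exp_neg : ConvexOn ℝ (Set.Ioi 0) fun y : ℝ => Real.exp (-y) := by
  refine convexOn_of_hasDerivWithinAt2_nonneg (convex_Ioi 0) (f' := fun y => -Real.exp (-y))
    (f'' := fun y => Real.exp (-y)) (by fun_prop) ?_ ?_ fun y _ => (Real.exp_pos _).le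
  · intro y _
    simpa using ((hasDerivAt_neg y).exp).hasDerivWithinAt
  · intro y _
    simpa using ((hasDerivAt_neg y).exp).fun_neg.hasDerivWithinAt

theorem convexOn_sinhGap_add_exp :
    ConvexOn ℝ (Set.Ioi 0) fun y => sinhGap y + 6 * Real.exp (-y) := by
  refine convexOn_of_hasDerivWithinAt2_nonneg (convex_Ioi 0)
    (f' := fun y => -Real.cosh y / Real.sinh y ^ 2 +
      Real.exp (-y) * (1 / y + 1 / y ^ 2) - 6 * Real.exp (-y))
    (f'' := fun y => 1 / Real.sinh y + 2 / Real.sinh y ^ 3 -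
      Real.exp (-y) * (1 / y + 2 / y ^ 2 + 2 / y ^ 3) + 6 * Real.exp (-y))
    (continuousOn_sinhGap.add (by fun_prop)) ?_ ?_ ?_
  · intro y hy
    rw [interior_Ioi] at hy
    have hy' : y ≠ 0 := ne_of_gt hy
    have hs : Real.sinh y ≠ 0 := (Real.sinh_pos_iff.2 hy).ne'
    have he : HasDerivAt (fun y : ℝ => Real.exp (-y)) (-Real.exp (-y)) y := by
      simpa using (hasDerivAt_neg y).exp
    have := (((hasDerivAt_const y (1 : ℝ)).div (Real.hasDerivAt_sinh y) hs).sub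
      (he.div (hasDerivAt_id y) hy')).add (he.const_mul 6)
    refine (this.congr_deriv ?_).hasDerivWithinAt
    simp only [id]
    field_simp
    ring
  · intro y hy
    rw [interior_Ioi] at hy
    have hy' : y ≠ 0 := ne_of_gt hy
    have hs : Real.sinh y ≠ 0 := (Real.sinh_pos_iff.2 hy).ne'
    have he : HasDerivAt (fun y : ℝ => Real.exp (-y)) (-Real.exp (-y)) y := by
      simpa using (hasDerivAt_neg y).exp
    have hi : HasDerivAt (fun y : ℝ => 1 / y + 1 / y ^ 2) (-1 / y ^ 2 - 2 / y ^ 3) y := by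
      have := ((hasDerivAt_const y (1 : ℝ)).div (hasDerivAt_id y) hy').add
        ((hasDerivAt_const y (1 : ℝ)).div (hasDerivAt_pow 2 y) (pow_ne_zero 2 hy'))
      refine this.congr_deriv ?_
      simp only [id]
      field_simp
      ring
    have hc : HasDerivAt (fun y : ℝ => -Real.cosh y / Real.sinh y ^ 2)
        (1 / Real.sinh y + 2 / Real.sinh y ^ 3) y := by
      have := (Real.hasDerivAt_cosh y).neg.div ((Real.hasDerivAt_sinh y).pow 2)
        (pow_ne_zero 2 hs)
      refine this.congr_deriv ?_
      have hcs := Real.cosh_sq y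
      simp only [Pi.pow_apply, Pi.neg_apply]
      field_simp
      norm_num
      linear_combination 2 * Real.sinh y * hcs
    refine (((hc.add (he.mul hi)).sub (he.const_mul 6)).congr_deriv ?_).hasDerivWithinAt
    field_simp
    ring
  · intro y hy
    rw [interior_Ioi] at hy
    exact sinhGap_second_deriv_lower_bound hy

theorem odd_mul_pos {x : ℝ} (hx : 0 < x) (n : ℕ) : 0 < (2 * (n : ℝ) + 1) * x := by positivity

theorem summable_exp_odd_mul {a x : ℝ} (ha : 0 < a) (hx : 0 < x) :
    Summable fun n : ℕ => Real.exp (-a * ((2 * n + 1) * x)) := by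
  have h : Summable fun n : ℕ => Real.exp (-(a * x)) * Real.exp (n * -(2 * a * x)) :=
    (Real.summable_exp_nat_mul_iff.2 (by simp; positivity)).mul_left _
  refine h.congr fun n => ?_
  rw [← Real.exp_add]
  ring_nf

theorem summable_sinhGap {x : ℝ} (hx : 0 < x) :
    Summable fun n : ℕ => sinhGap ((2 * n + 1) * x) :=
  Summable.of_nonneg_of_le (fun n => (sinhGap_bounds (odd_mul_pos hx n)).1)
    (fun n => (sinhGap_bounds (odd_mul_pos hx n)).2)
    ((summable_exp_odd_mul (by norm_num) hx).mul_left 4)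

theorem abs_sinhGap_midpoint_sub_le {x : ℝ} (hx : 0 < x) (hx1 : x ≤ 1) :
    |2 * x * ∑' n : ℕ, sinhGap ((2 * n + 1) * x) -
      (Real.eulerMascheroniConstant + Real.log 2)| ≤ 14 * x ^ 2 := by
  have hse : Summable fun n : ℕ => Real.exp (-((2 * n + 1) * x)) := by
    simpa using summable_exp_odd_mul one_pos hx
  have hie : MeasureTheory.IntegrableOn (fun y : ℝ => Real.exp (-y)) (Set.Ioi 0) := by
    simpa using integrableOn_exp_mul_Ioi (a := -1) (by norm_num) 0
  have hexp : ∀ y, 0 < y → Real.exp (-y) ≤ Real.exp (-x) + x := fun y hy => by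
    have h1 : Real.exp (-y) < 1 := Real.exp_lt_one_iff.2 (by linarith)
    linarith [Real.add_one_le_exp (-x)]
  have h1 := convexOn_sinhGap_add_exp.abs_integral_sub_midpoint_le
    (integrableOn_sinhGap.add (hie.const_mul 6)) (C := 8) hx
    ((summable_sinhGap hx).add (hse.mul_left 6)) fun y hy _ => by
      linarith [hexp y hy, sinhGap_le_one hy, one_sub_le_sinhGap hx hx1]
  have h2 := convexOn_exp_neg.abs_integral_sub_midpoint_le hie (C := 1) hx hse
    fun y hy _ => by linarith [hexp y hy]
  rw [MeasureTheory.integral_add integrableOn_sinhGap (hie.const_mul 6),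
    MeasureTheory.integral_const_mul, (summable_sinhGap hx).tsum_add (hse.mul_left 6),
    tsum_mul_left, integral_sinhGap] at h1
  rw [abs_le] at h1 h2 ⊢
  constructor <;> linarith [h1.1, h1.2, h2.1, h2.2]

theorem hasSum_exp_neg_div_odd {x : ℝ} (hx : 0 < x) :
    HasSum (fun n : ℕ => Real.exp (-((2 * n + 1) * x)) / ((2 * n + 1) * x))
      ((Real.log (Real.cosh (x / 2)) - Real.log (Real.sinh (x / 2))) / (2 * x)) := by
  have h0 := Real.exp_pos (-x)
  have h1 : Real.exp (-x) < 1 := Real.exp_lt_one_iff.2 (by linarith)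
  have hs : 0 < Real.sinh (x / 2) := Real.sinh_pos_iff.2 (by linarith)
  have hq : |Real.exp (-x)| < 1 := by rwa [abs_of_pos h0]
  have hlog : Real.log (1 + Real.exp (-x)) - Real.log (1 - Real.exp (-x)) =
      Real.log (Real.cosh (x / 2)) - Real.log (Real.sinh (x / 2)) := by
    rw [← Real.log_div (by positivity) (by linarith),
      ← Real.log_div (Real.cosh_pos _).ne' hs.ne']
    congr 1
    rw [div_eq_div_iff (by linarith) hs.ne', Real.sinh_eq, Real.cosh_eq]
    have h2 : Real.exp (-x) = Real.exp (-(x / 2)) * Real.exp (-(x / 2)) := by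
      rw [← Real.exp_add]; ring_nf
    have h3 : Real.exp (x / 2) * Real.exp (-(x / 2)) = 1 := by rw [← Real.exp_add]; simp
    rw [h2]
    linear_combination Real.exp (-(x / 2)) * h3
  have h := (Real.hasSum_log_sub_log_of_abs_lt_one hq).div_const (2 * x)
  rw [hlog] at h
  refine (congrArg (HasSum · _) (funext fun n => ?_)).mpr h
  have he : Real.exp (-((2 * n + 1) * x)) = Real.exp (-x) ^ (2 * n + 1) := by
    rw [← Real.exp_nat_mul]
    push_cast
    ring_nf
  rw [he]
  field_simp

theorem abs_tsum_inv_sinh_sub_le {x : ℝ} (hx : 0 < x) (hx1 : x ≤ 1) :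
    |2 * x * ∑' n : ℕ, 1 / Real.sinh ((2 * n + 1) * x) -
      (Real.eulerMascheroniConstant + Real.log 2 +
        Real.log (Real.cosh (x / 2)) - Real.log (Real.sinh (x / 2)))| ≤ 14 * x ^ 2 := by
  have h := ((summable_sinhGap hx).hasSum.add (hasSum_exp_neg_div_odd hx)).tsum_eq
  simp only [sinhGap, sub_add_cancel] at h
  rw [h]
  convert abs_sinhGap_midpoint_sub_le hx hx1 using 2
  simp only [sinhGap]
  field_simp
  ring

theorem exp_div_exp_two_mul_sub_one (y : ℝ) :
    Real.exp y / (Real.exp (2 * y) - 1) = 1 / 2 * (1 / Real.sinh y) := by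
  have h1 : Real.exp (2 * y) = Real.exp y * Real.exp y := by rw [← Real.exp_add]; ring_nf
  have h2 : Real.exp y * Real.exp (-y) = 1 := by rw [← Real.exp_add]; simp
  have h3 : Real.exp (2 * y) - 1 = Real.exp y * (2 * Real.sinh y) := by
    rw [Real.sinh_eq, h1]; linear_combination h2
  rw [h3, div_mul_eq_div_div, div_self (Real.exp_pos y).ne', one_div_mul_one_div]

theorem C11sym_eq {r ε : ℝ} (hξ : xi0 r ε ≠ 0) :
    C11sym r ε = 2 * π * (alphaTilde r ε / xi0 r ε) *
      (2 * xi0 r ε * ∑' n : ℕ, 1 / Real.sinh ((2 * n + 1) * xi0 r ε)) := by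
  have h : ∀ n : ℕ, Real.exp ((2 * n + 1) * xi0 r ε) /
      (Real.exp (2 * (2 * n + 1) * xi0 r ε) - 1) =
      1 / 2 * (1 / Real.sinh ((2 * n + 1) * xi0 r ε)) := fun n => by
    rw [mul_assoc 2, exp_div_exp_two_mul_sub_one]
  rw [C11sym, tsum_congr h, tsum_mul_left]
  generalize ∑' n : ℕ, 1 / Real.sinh ((2 * n + 1) * xi0 r ε) = T
  field_simp
  ring

theorem sinh_xi0 (r ε : ℝ) : Real.sinh (xi0 r ε) = alphaTilde r ε / r := Real.sinh_arsinh _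

theorem alphaTilde_pos {r ε : ℝ} (hr : 0 < r) (hε : 0 < ε) : 0 < alphaTilde r ε :=
  Real.sqrt_pos.2 (by positivity)

theorem alphaTilde_sq {r ε : ℝ} (hr : 0 < r) (hε : 0 < ε) :
    alphaTilde r ε ^ 2 = ε * (r + ε / 4) := Real.sq_sqrt (by positivity)

theorem xi0_pos {r ε : ℝ} (hr : 0 < r) (hε : 0 < ε) : 0 < xi0 r ε :=
  Real.arsinh_pos_iff.2 (div_pos (alphaTilde_pos hr hε) hr)

theorem two_mul_sinh_half_xi0 {r ε : ℝ} (hr : 0 < r) (hε : 0 < ε) :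
    2 * Real.sinh (xi0 r ε / 2) = Real.sqrt ε / Real.sqrt r := by
  have hs : 0 < Real.sinh (xi0 r ε / 2) := Real.sinh_pos_iff.2 (half_pos (xi0_pos hr hε))
  have hcosh : Real.cosh (xi0 r ε) = 1 + ε / (2 * r) := by
    refine (pow_left_inj₀ (Real.cosh_pos _).le (by positivity) two_ne_zero).1 ?_
    rw [Real.cosh_sq, sinh_xi0, div_pow, alphaTilde_sq hr hε]
    field_simp
    ring
  have h2 : Real.cosh (xi0 r ε) = 1 + 2 * Real.sinh (xi0 r ε / 2) ^ 2 := by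
    have h3 := Real.cosh_two_mul (xi0 r ε / 2)
    rw [mul_div_cancel₀ _ two_ne_zero, Real.cosh_sq] at h3
    linarith
  refine (pow_left_inj₀ (by positivity) (by positivity) two_ne_zero).1 ?_
  rw [div_pow, Real.sq_sqrt hε.le, Real.sq_sqrt hr.le]
  have h4 : 2 * Real.sinh (xi0 r ε / 2) ^ 2 = ε / (2 * r) := by linarith
  rw [mul_pow]
  calc _ = 2 * (2 * Real.sinh (xi0 r ε / 2) ^ 2) := by ring
    _ = ε / r := by rw [h4]; field_simp

theorem log_cosh_half_le {x : ℝ} : |Real.log (Real.cosh (x / 2))| ≤ x ^ 2 := by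
  rw [abs_of_nonneg (Real.log_nonneg (Real.one_le_cosh _)),
    Real.log_le_iff_le_exp (Real.cosh_pos _)]
  refine (Real.cosh_le_exp_half_sq _).trans (Real.exp_le_exp.2 ?_)
  nlinarith [sq_nonneg x]

theorem C11_asymptotics (r : ℝ) (hr : 0 < r) :
    (fun ε => C11sym r ε -
        2 * π * (alphaTilde r ε / xi0 r ε) *
          (Real.eulerMascheroniConstant + 2 * Real.log 2 +
            Real.log (Real.sqrt r) - Real.log (Real.sqrt ε)))
      =O[𝓝[>] (0 : ℝ)] (fun ε => ε) := by
  have hsmall : ∀ᶠ ε in 𝓝[>] (0 : ℝ), xi0 r ε ≤ 1 := by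
    have hc : Continuous fun ε => xi0 r ε := by
      unfold xi0 alphaTilde
      exact Real.continuous_arsinh.comp (by fun_prop)
    have h0 : xi0 r 0 < 1 := by simp [xi0, alphaTilde]
    exact nhdsWithin_le_nhds ((hc.continuousAt.eventually (gt_mem_nhds h0)).mono fun _ h => h.le)
  refine Asymptotics.IsBigO.of_bound (2 * π * 15 * 2) ?_
  filter_upwards [self_mem_nhdsWithin, hsmall, nhdsWithin_le_nhds (gt_mem_nhds hr)]
    with ε hε hξ1 hεr
  have hε0 : 0 < ε := hε
  have hξ := xi0_pos hr hε0
  have hα := alphaTilde_pos hr hε0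
  have hmain := abs_tsum_inv_sinh_sub_le hξ hξ1
  have hcosh := log_cosh_half_le (x := xi0 r ε)
  have hs : 0 < Real.sinh (xi0 r ε / 2) := Real.sinh_pos_iff.2 (half_pos hξ)
  have hlog : Real.log 2 + Real.log (Real.sinh (xi0 r ε / 2)) =
      Real.log (Real.sqrt ε) - Real.log (Real.sqrt r) := by
    rw [← Real.log_mul two_ne_zero hs.ne', two_mul_sinh_half_xi0 hr hε0,
      Real.log_div (Real.sqrt_pos.2 hε0).ne' (Real.sqrt_pos.2 hr).ne']
  rw [C11sym_eq hξ.ne', ← mul_sub, norm_mul, Real.norm_of_nonneg (by positivity),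
    Real.norm_of_nonneg hε0.le, Real.norm_eq_abs]
  have hbr : |2 * xi0 r ε * ∑' n : ℕ, 1 / Real.sinh ((2 * n + 1) * xi0 r ε) -
      (Real.eulerMascheroniConstant + 2 * Real.log 2 +
            Real.log (Real.sqrt r) - Real.log (Real.sqrt ε))| ≤ 15 * xi0 r ε ^ 2 := by
    rw [abs_le] at hmain hcosh ⊢
    constructor <;> linarith [hmain.1, hmain.2, hcosh.1, hcosh.2]
  have hαξ : alphaTilde r ε * xi0 r ε ≤ 2 * ε := by
    have h1 : xi0 r ε ≤ alphaTilde r ε / r := by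
      rw [← sinh_xi0]; exact Real.self_le_sinh_iff.2 hξ.le
    calc alphaTilde r ε * xi0 r ε ≤ alphaTilde r ε * (alphaTilde r ε / r) := by gcongr
      _ = alphaTilde r ε ^ 2 / r := by ring
      _ ≤ 2 * ε := by
        rw [alphaTilde_sq hr hε0, div_le_iff₀ hr]
        nlinarith
  calc _ ≤ 2 * π * (alphaTilde r ε / xi0 r ε) * (15 * xi0 r ε ^ 2) := by gcongr
    _ = 2 * π * 15 * (alphaTilde r ε * xi0 r ε) := by field_simp
    _ ≤ 2 * π * 15 * (2 * ε) := by gcongr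
    _ = 2 * π * 15 * 2 * ε := by ring
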